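/- Let Γ be a group satisfying the Følner condition: for every finite subset S ⊆ Γ and every real ε > 0 there exists a finite nonempty subset F ⊆ Γ with |S·F ∪ F| < (1+ε)·|F|. Then the left translation action of Γ on the Hilbert space ℓ²(Γ; ℂ), given by (γ·G)(δ) = G(γ⁻¹δ), is algebraically amenable. -/

import Mathlib

open scoped ENNReal Pointwise

/-- A linear action `ρ` of a group `Γ` on a complex vector space `V` is *algebraically
amenable* if for every finite list `g₁, …, g_m` of elements of `Γ` and every `ε > 0`
there is a nonzero finite-dimensional subspace `W ⊆ V` with
`dim_ℂ (g₁W + ⋯ + g_mW) < (1 + ε) · dim_ℂ W`. -/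
def AlgebraicallyAmenableAction {Γ V : Type*} [Group Γ] [AddCommGroup V] [Module ℂ V]
    (ρ : Γ → (V →ₗ[ℂ] V)) : Prop :=
  ∀ (m : ℕ) (g : Fin m → Γ) (ε : ℝ), 0 < ε →
    ∃ W : Submodule ℂ V, W ≠ ⊥ ∧ FiniteDimensional ℂ W ∧
      (Module.finrank ℂ ↥(⨆ i, W.map (ρ (g i))) : ℝ) <
        (1 + ε) * (Module.finrank ℂ W : ℝ)

/-- The left translation operator `(γ · G)(δ) = G(γ⁻¹δ)` on `ℓ²(Γ; ℂ)`, as a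
`ℂ`-linear map. -/
noncomputable def lpTranslate {Γ : Type*} [Group Γ] (γ : Γ) :
    lp (fun _ : Γ => ℂ) 2 →ₗ[ℂ] lp (fun _ : Γ => ℂ) 2 where
  toFun f := ⟨fun δ => f (γ⁻¹ * δ), by
    have hf : Memℓp (⇑f) 2 := lp.memℓp f
    rw [memℓp_gen_iff (by norm_num)] at hf
    exact (memℓp_gen_iff (by norm_num)).2
      (((Equiv.mulLeft γ⁻¹).summable_iff
        (f := fun δ : Γ => ‖f δ‖ ^ (2 : ℝ≥0∞).toReal)).2 hf)⟩
  map_add' f g := by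
    ext δ
    simp only [lp.coeFn_add, Pi.add_apply]
  map_smul' c f := by
    ext δ
    simp only [lp.coeFn_smul, Pi.smul_apply, RingHom.id_apply]

theorem lpTranslate_single {Γ : Type*} [Group Γ] [DecidableEq Γ] (γ δ : Γ) (a : ℂ) :
    lpTranslate γ (lp.single (E := fun _ : Γ => ℂ) 2 δ a) =
      lp.single (E := fun _ : Γ => ℂ) 2 (γ * δ) a := by
  ext x
  change (Pi.single δ a : Γ → ℂ) (γ⁻¹ * x) = (Pi.single (γ * δ) a : Γ → ℂ) x
  simp only [Pi.single_apply, inv_mul_eq_iff_eq_mul]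

theorem linearIndependent_lp_single {α : Type*} [DecidableEq α] :
    LinearIndependent ℂ (fun i : α => lp.single (E := fun _ : α => ℂ) 2 i (1 : ℂ)) := by
  refine linearIndependent_iff'.2 fun s c hc i hi => ?_
  have h := congrArg (fun f : lp (fun _ : α => ℂ) 2 => f i) hc
  simp only [lp.coeFn_sum] at h
  have hsum := (Finset.sum_apply i s _).symm.trans h
  simpa [Pi.single_apply, hi] using hsum

/-- The functions in `ℓ²(α; ℂ)` supported on the finite set `F`, as the span of the
indicator functions of its points. -/
noncomputable def lpSupported {α : Type*} [DecidableEq α] (F : Finset α) :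
    Submodule ℂ (lp (fun _ : α => ℂ) 2) :=
  Submodule.span ℂ (Set.range fun i : F => lp.single (E := fun _ : α => ℂ) 2 (i : α) (1 : ℂ))

instance {α : Type*} [DecidableEq α] (F : Finset α) : FiniteDimensional ℂ (lpSupported F) :=
  FiniteDimensional.span_of_finite ℂ (Set.finite_range _)

theorem finrank_lpSupported {α : Type*} [DecidableEq α] (F : Finset α) :
    Module.finrank ℂ (lpSupported F) = F.card := by
  have h := finrank_span_eq_card
    ((linearIndependent_lp_single (α := α)).comp (fun i : F => (i : α)) Subtype.val_injective)
  rw [Fintype.card_coe] at h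
  exact h

theorem map_lpTranslate_lpSupported_le {Γ : Type*} [Group Γ] [DecidableEq Γ] {γ : Γ}
    {F K : Finset Γ} (h : ∀ δ ∈ F, γ * δ ∈ K) :
    (lpSupported F).map (lpTranslate γ) ≤ lpSupported K := by
  rw [lpSupported, Submodule.map_span, Submodule.span_le]
  rintro _ ⟨_, ⟨⟨δ, hδ⟩, rfl⟩, rfl⟩
  rw [lpTranslate_single]
  exact Submodule.subset_span ⟨⟨γ * δ, h δ hδ⟩, rfl⟩

/-- If `Γ` satisfies the Følner condition, then the left translation action of `Γ` on
`ℓ²(Γ; ℂ)` is algebraically amenable. -/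
theorem translation_action_algebraically_amenable_of_folner (Γ : Type*) [Group Γ]
    [DecidableEq Γ]
    (hFolner : ∀ (S : Finset Γ) (ε : ℝ), 0 < ε → ∃ F : Finset Γ, F.Nonempty ∧
      ((S * F ∪ F).card : ℝ) < (1 + ε) * (F.card : ℝ)) :
    AlgebraicallyAmenableAction (fun γ : Γ => lpTranslate γ) := by
  intro m g ε hε
  obtain ⟨F, hF, hcard⟩ := hFolner (Finset.univ.image g) ε hε
  refine ⟨lpSupported F, ?_, inferInstance, ?_⟩
  · intro h
    have h0 := finrank_lpSupported F
    rw [h, finrank_bot] at h0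
    exact hF.card_pos.ne h0
  · have hle : ⨆ i, (lpSupported F).map (lpTranslate (g i)) ≤
        lpSupported (Finset.univ.image g * F ∪ F) :=
      iSup_le fun i => map_lpTranslate_lpSupported_le fun δ hδ =>
        Finset.mem_union_left _
          (Finset.mul_mem_mul (Finset.mem_image_of_mem g (Finset.mem_univ i)) hδ)
    have hdim := Submodule.finrank_mono hle
    rw [finrank_lpSupported] at hdim
    rw [finrank_lpSupported]
    exact lt_of_le_of_lt (Nat.cast_le.2 hdim) hcard
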